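/- Let n ≥ 1, let B̄ be the closed unit ball in ℂⁿ ≅ ℝ^{2n}, let G be a holomorphic function on an open neighborhood of B̄, and set g = Re G. Suppose g attains its maximum over B̄ at a unique point p, that p lies on the unit sphere S^{2n−1}, and that the radial derivative of g at p is strictly positive, i.e. (D g)(p) applied to the vector p is > 0. Then the ratio (∫_{S^{2n−1}} e^{(n/(n+1))·k·g(ω)} dσ(ω)) / (∫_{B̄} e^{k·g(x)} dx)^{n/(n+1)} tends to +∞ as k → ∞. -/

import Mathlib

open MeasureTheory Metric Filter

noncomputable instance (n : ℕ) : InnerProductSpace ℝ (EuclideanSpace ℂ (Fin n)) :=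
  InnerProductSpace.rclikeToReal ℂ _

noncomputable instance (n : ℕ) : MeasurableSpace (EuclideanSpace ℂ (Fin n)) := borel _

instance (n : ℕ) : BorelSpace (EuclideanSpace ℂ (Fin n)) := ⟨rfl⟩

lemma aux_quad {E : Type*} [NormedAddCommGroup E] [NormedSpace ℂ E] {G : E → ℂ} {c : E} {R M : ℝ}
    (hR : 0 < R) (hd : DifferentiableOn ℂ G (ball c R)) (hM : ∀ x ∈ ball c R, ‖G x‖ ≤ M)
    {z : E} (hz : z ∈ ball c R) :
    ‖G z - G c - fderiv ℂ G c (z - c)‖ ≤ (4 * M) * (‖z - c‖ / R) ^ 2 := by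
  have hc : c ∈ ball c R := mem_ball_self hR
  have hmaps : Set.MapsTo G (ball c R) (closedBall (G c) (2 * M)) := by
    intro x hx
    rw [mem_closedBall, dist_eq_norm]
    linarith [norm_sub_le (G x) (G c), hM x hx, hM c hc]
  have hfd := Complex.norm_fderiv_le_div_of_mapsTo_ball hd hmaps hR
  have hGc : DifferentiableAt ℂ G c := hd.differentiableAt (ball_mem_nhds _ hR)
  have hlin : ∀ x ∈ ball c R, ‖fderiv ℂ G c (x - c)‖ ≤ 2 * M := by
    intro x hx
    have h1 := (fderiv ℂ G c).le_opNorm (x - c)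
    have h2 : ‖x - c‖ ≤ R := by rw [← dist_eq_norm]; exact (mem_ball.1 hx).le
    have hM0 : 0 ≤ M := (norm_nonneg _).trans (hM c hc)
    calc _ ≤ _ := h1
      _ ≤ 2 * M / R * R := by gcongr
      _ = 2 * M := by field_simp
  have key := Complex.dist_le_mul_div_pow_of_mapsTo_ball_of_isLittleO (n := 1) (R₂ := 4 * M)
    (f := fun x => G x - fderiv ℂ G c (x - c)) (c := c) (z := z) (R₁ := R) ?_ ?_ ?_ hz
  · simp only [dist_eq_norm, sub_self, map_zero, sub_zero] at key
    rw [show G z - G c - fderiv ℂ G c (z - c) = G z - fderiv ℂ G c (z - c) - G c by ring]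
    exact key
  · exact hd.sub (by fun_prop)
  · intro x hx
    rw [mem_closedBall, dist_eq_norm]
    have h1 := hmaps hx
    rw [mem_closedBall, dist_eq_norm] at h1
    have h2 := norm_sub_le (G x - G c) (fderiv ℂ G c (x - c))
    have h3 := hlin x hx
    simp only [sub_self, map_zero, sub_zero]
    rw [show G x - (fderiv ℂ G c) (x - c) - G c = G x - G c - (fderiv ℂ G c) (x - c) by ring]
    linarith
  · have := hGc.hasFDerivAt.isLittleO
    simp only [sub_self, map_zero, sub_zero, pow_one]
    refine (this.norm_right).congr_left (fun x => by ring)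

lemma aux_quad_unif (n : ℕ) (U : Set (EuclideanSpace ℂ (Fin n))) (hU : IsOpen U)
    (hBU : closedBall (0 : EuclideanSpace ℂ (Fin n)) 1 ⊆ U)
    (G : EuclideanSpace ℂ (Fin n) → ℂ) (hG : DifferentiableOn ℂ G U) :
    ∃ C R : ℝ, 0 ≤ C ∧ 0 < R ∧ ∀ c ∈ closedBall (0 : EuclideanSpace ℂ (Fin n)) 1,
      ∀ z, ‖z - c‖ < R → |(G z).re - (G c).re - (fderiv ℂ G c (z - c)).re| ≤ C * ‖z - c‖ ^ 2 := by
  obtain ⟨R, hR, hRU⟩ := (isCompact_closedBall (0 : EuclideanSpace ℂ (Fin n)) 1).exists_cthickening_subset_open hU hBU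
  have hcomp : IsCompact (cthickening R (closedBall (0 : EuclideanSpace ℂ (Fin n)) 1)) :=
    (isCompact_closedBall _ _).cthickening
  obtain ⟨M, hM⟩ := hcomp.exists_bound_of_continuousOn (hG.continuousOn.mono hRU)
  have hsub : ∀ c ∈ closedBall (0 : EuclideanSpace ℂ (Fin n)) 1, ball c R ⊆
      cthickening R (closedBall (0 : EuclideanSpace ℂ (Fin n)) 1) := fun c hc x hx =>
    mem_cthickening_of_dist_le x c R _ hc (mem_ball.1 hx).le
  have hM0 : 0 ≤ M := (norm_nonneg _).trans
    (hM 0 (hsub 0 (by simp) (mem_ball_self hR)))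
  refine ⟨4 * M / R ^ 2, R, by positivity, hR, fun c hc z hz => ?_⟩
  have := aux_quad hR (hG.mono ((hsub c hc).trans hRU)) (fun x hx => hM x (hsub c hc hx))
    (z := z) (by rwa [mem_ball, dist_eq_norm])
  rw [← Complex.sub_re, ← Complex.sub_re]
  refine (Complex.abs_re_le_norm _).trans (this.trans (le_of_eq ?_))
  field_simp

lemma aux_fderiv_re (n : ℕ) (G : EuclideanSpace ℂ (Fin n) → ℂ) (p v : EuclideanSpace ℂ (Fin n))
    (hG : DifferentiableAt ℂ G p) :
    fderiv ℝ (fun z => (G z).re) p v = (fderiv ℂ G p v).re := by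
  have h := Complex.reCLM.hasFDerivAt.comp p (hG.hasFDerivAt.restrictScalars ℝ)
  have h2 : HasFDerivAt (fun z => (G z).re) _ p := h
  rw [h2.fderiv]
  simp

/-- lower quadratic bound on the sphere -/
lemma aux_lower (n : ℕ) (U : Set (EuclideanSpace ℂ (Fin n))) (hU : IsOpen U)
    (hBU : closedBall (0 : EuclideanSpace ℂ (Fin n)) 1 ⊆ U)
    (G : EuclideanSpace ℂ (Fin n) → ℂ) (hG : DifferentiableOn ℂ G U)
    (p : EuclideanSpace ℂ (Fin n))
    (hmax : ∀ x ∈ closedBall (0 : EuclideanSpace ℂ (Fin n)) 1, (G x).re ≤ (G p).re)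
    (hps : p ∈ sphere (0 : EuclideanSpace ℂ (Fin n)) 1)
    (hrad : 0 < fderiv ℝ (fun z => (G z).re) p p) :
    ∃ C R : ℝ, 0 ≤ C ∧ 0 < R ∧ ∀ w ∈ sphere (0 : EuclideanSpace ℂ (Fin n)) 1,
      ‖w - p‖ < R → (G p).re - C * ‖w - p‖ ^ 2 ≤ (G w).re := by
  obtain ⟨C, R, hC, hR, h⟩ := aux_quad_unif n U hU hBU G hG
  have hpB := sphere_subset_closedBall hps
  have hGp : DifferentiableAt ℂ G p := hG.differentiableAt (hU.mem_nhds (hBU hpB))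
  have hre : DifferentiableAt ℝ (fun z => (G z).re) p :=
    (Complex.reCLM.hasFDerivAt.comp p (hGp.hasFDerivAt.restrictScalars ℝ)).differentiableAt
  set L := fderiv ℝ (fun z => (G z).re) p with hL
  have hLB : ∀ y ∈ closedBall (0 : EuclideanSpace ℂ (Fin n)) 1, L y ≤ L p := by
    intro y hy
    have h1 : IsLocalMaxOn (fun z => (G z).re) (closedBall (0 : EuclideanSpace ℂ (Fin n)) 1) p :=
      (isMaxOn_iff.2 hmax).localize
    have h2 := h1.hasFDerivWithinAt_nonpos hre.hasFDerivAt.hasFDerivWithinAt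
      (y := y - p) (mem_posTangentConeAt_of_segment_subset (by
        rw [add_sub_cancel]
        exact (convex_closedBall _ _).segment_subset hpB hy))
    rw [map_sub] at h2; linarith
  refine ⟨C + L p, R, by positivity, hR, fun w hw hwR => ?_⟩
  have h1 := h p hpB w hwR
  rw [← aux_fderiv_re n G p _ hGp, ← hL] at h1
  have hp1 : ‖p‖ = 1 := by simpa using hps
  have hw1 : ‖w‖ = 1 := by simpa using hw
  have hn : ‖(2:ℝ) • p - w‖ ^ 2 = 1 + 2 * ‖w - p‖ ^ 2 := by
    rw [@norm_sub_sq_real, @norm_sub_sq_real, norm_smul, hp1, hw1, real_inner_smul_left, real_inner_comm]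
    norm_num; ring
  set s := ‖(2:ℝ) • p - w‖
  have hs : s ≤ 1 + ‖w - p‖ ^ 2 := by
    have : 0 ≤ s := norm_nonneg _
    nlinarith [sq_nonneg (‖w - p‖ ^ 2)]
  have hs1 : 1 ≤ s := by
    have : 0 ≤ s := norm_nonneg _
    nlinarith [sq_nonneg (‖w - p‖)]
  have h3 := hLB (s⁻¹ • ((2:ℝ) • p - w)) (by
    rw [mem_closedBall_zero_iff, norm_smul, norm_inv, Real.norm_of_nonneg (by linarith)]
    exact (inv_mul_cancel₀ (by linarith)).le)
  rw [map_smul, map_sub, map_smul, smul_eq_mul, smul_eq_mul, inv_mul_le_iff₀ (by linarith)] at h3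
  rw [map_sub] at h1
  have := (abs_le.1 h1).1
  nlinarith [mul_le_mul_of_nonneg_right hs hrad.le]

/-- radial bound -/
lemma aux_radial (n : ℕ) (U : Set (EuclideanSpace ℂ (Fin n))) (hU : IsOpen U)
    (hBU : closedBall (0 : EuclideanSpace ℂ (Fin n)) 1 ⊆ U)
    (G : EuclideanSpace ℂ (Fin n) → ℂ) (hG : DifferentiableOn ℂ G U)
    (p : EuclideanSpace ℂ (Fin n))
    (hmax : ∀ x ∈ closedBall (0 : EuclideanSpace ℂ (Fin n)) 1, (G x).re ≤ (G p).re)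
    (huniq : ∀ x ∈ closedBall (0 : EuclideanSpace ℂ (Fin n)) 1,
      (G x).re = (G p).re → x = p)
    (hps : p ∈ sphere (0 : EuclideanSpace ℂ (Fin n)) 1)
    (hrad : 0 < fderiv ℝ (fun z => (G z).re) p p) :
    ∃ c ε : ℝ, 0 < c ∧ 0 < ε ∧ ∀ w ∈ sphere (0 : EuclideanSpace ℂ (Fin n)) 1,
      ∀ r : ℝ, 0 < r → r ≤ 1 → (G (r • w)).re ≤ (G w).re - c * (1 - r) ∨
        (G (r • w)).re ≤ (G p).re - ε := by
  obtain ⟨C, R, hC, hR, h⟩ := aux_quad_unif n U hU hBU G hG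
  have hpB := sphere_subset_closedBall hps
  have hp1 : ‖p‖ = 1 := by simpa using hps
  have hGp : DifferentiableAt ℂ G p := hG.differentiableAt (hU.mem_nhds (hBU hpB))
  rw [aux_fderiv_re n G p _ hGp] at hrad
  set D := (fderiv ℂ G p p).re with hD
  -- quadratic bound on rays
  have hray : ∀ w ∈ sphere (0 : EuclideanSpace ℂ (Fin n)) 1, ∀ t : ℝ, 0 ≤ t → t < R →
      |(G ((1 - t) • w)).re - (G w).re + t * (fderiv ℂ G w w).re| ≤ C * t ^ 2 := by
    intro w hw t ht htR
    have hw1 : ‖w‖ = 1 := by simpa using hw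
    have e : (1 - t) • w - w = -(((t : ℝ) : ℂ) • w) := by
      rw [sub_smul, one_smul, Complex.coe_smul]; abel
    have hnorm : ‖(1 - t) • w - w‖ = t := by
      rw [e, norm_neg, norm_smul, hw1, mul_one, Complex.norm_real, Real.norm_of_nonneg ht]
    have := h w (sphere_subset_closedBall hw) ((1 - t) • w) (by rw [hnorm]; exact htR)
    rw [hnorm, e, map_neg, map_smul, smul_eq_mul, Complex.neg_re, Complex.re_ofReal_mul] at this
    rwa [sub_neg_eq_add] at this
  obtain ⟨t0, ht0, ht0R, ht01, ht0C⟩ : ∃ t0 : ℝ, 0 < t0 ∧ t0 < R ∧ t0 < 1 ∧ C * t0 ≤ D / 8 := by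
    refine ⟨min (min (R / 2) (1 / 2)) (D / (8 * (C + 1))), by positivity, ?_, ?_, ?_⟩
    · exact (min_le_left _ _).trans_lt ((min_le_left _ _).trans_lt (by linarith))
    · exact (min_le_left _ _).trans_lt ((min_le_right _ _).trans_lt (by norm_num))
    · calc _ ≤ C * (D / (8 * (C + 1))) := by gcongr; exact min_le_right _ _
        _ ≤ (C + 1) * (D / (8 * (C + 1))) := by gcongr; linarith
        _ = D / 8 := by field_simp
  have hcont : ContinuousAt (fun w => (G w).re - (G ((1 - t0) • w)).re) p := by
    have h1 : ContinuousAt G p := hGp.continuousAt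
    have h2 : ContinuousAt G ((1 - t0) • p) := by
      refine (hG.differentiableAt (hU.mem_nhds (hBU ?_))).continuousAt
      rw [mem_closedBall_zero_iff, norm_smul, hp1, Real.norm_of_nonneg (by linarith)]
      linarith
    have h3 : ContinuousAt (fun w : EuclideanSpace ℂ (Fin n) => G ((1 - t0) • w)) p :=
      ContinuousAt.comp (f := fun w : EuclideanSpace ℂ (Fin n) => (1 - t0) • w) h2
        (continuous_const_smul _).continuousAt
    exact (Complex.continuous_re.continuousAt.comp h1).sub (Complex.continuous_re.continuousAt.comp h3)
  have hval : t0 * (6 * D / 8) < (G p).re - (G ((1 - t0) • p)).re := by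
    have := (abs_le.1 (hray p hps t0 ht0.le ht0R)).2
    nlinarith
  obtain ⟨δ, hδ, hδ'⟩ := Metric.eventually_nhds_iff.1 (hcont.eventually_const_lt hval)
  set η := min t0 (δ / 2) with hη
  have hη0 : 0 < η := by positivity
  have hηt : η ≤ t0 := min_le_left _ _
  have hηδ : 2 * η ≤ δ := by linarith [min_le_right t0 (δ / 2)]
  -- compactness
  obtain ⟨ε, hε, hε'⟩ : ∃ ε > 0, ∀ x ∈ closedBall (0 : EuclideanSpace ℂ (Fin n)) 1, η ≤ dist x p →
      (G x).re ≤ (G p).re - ε := by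
    have hK : IsCompact (closedBall (0 : EuclideanSpace ℂ (Fin n)) 1 \ ball p η) :=
      (isCompact_closedBall _ _).diff isOpen_ball
    rcases Set.eq_empty_or_nonempty (closedBall (0 : EuclideanSpace ℂ (Fin n)) 1 \ ball p η) with he | he
    · refine ⟨1, one_pos, fun x hx hd => ?_⟩
      have : x ∈ closedBall (0 : EuclideanSpace ℂ (Fin n)) 1 \ ball p η := ⟨hx, by simpa using hd⟩
      rw [he] at this; exact this.elim
    · obtain ⟨y, hy, hym⟩ := hK.exists_isMaxOn he (f := fun x => (G x).re)
        (Complex.continuous_re.comp_continuousOn (hG.continuousOn.mono (Set.sdiff_subset.trans hBU)))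
      refine ⟨(G p).re - (G y).re, ?_, fun x hx hd => ?_⟩
      · rcases (hmax y hy.1).lt_or_eq with h1 | h1
        · linarith
        · have := huniq y hy.1 h1
          exact absurd (this ▸ mem_ball_self hη0) hy.2
      · have : (G x).re ≤ (G y).re := hym (show x ∈ _ from ⟨hx, by simpa using hd⟩)
        linarith
  refine ⟨D / 2, ε, by positivity, hε, fun w hw r hr hr1 => ?_⟩
  have hw1 : ‖w‖ = 1 := by simpa using hw
  have hrw : ‖r • w‖ = r := by rw [norm_smul, hw1, Real.norm_of_nonneg hr.le, mul_one]
  rcases le_or_gt η (dist (r • w) p) with h1 | h1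
  · right
    exact hε' _ (by rw [mem_closedBall_zero_iff, hrw]; exact hr1) h1
  · left
    have h2 : 1 - r < η := by
      have := norm_sub_norm_le p (r • w)
      rw [hp1, hrw, ← dist_eq_norm, dist_comm] at this
      linarith
    have h3 : dist w (r • w) = 1 - r := by
      rw [dist_eq_norm, show w - r • w = (1 - r) • w by rw [sub_smul, one_smul], norm_smul, hw1,
        Real.norm_of_nonneg (by linarith), mul_one]
    have h4 := hδ' (y := w) (by linarith [dist_triangle w (r • w) p])
    have h5 := (abs_le.1 (hray w hw t0 ht0.le ht0R)).1
    have h6 : 5 * D / 8 ≤ (fderiv ℂ G w w).re := by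
      have : t0 * (5 * D / 8) ≤ t0 * (fderiv ℂ G w w).re := by nlinarith
      exact le_of_mul_le_mul_left this ht0
    have h7 := (abs_le.1 (hray w hw (1 - r) (by linarith) (by linarith))).2
    rw [sub_sub_cancel] at h7
    have h8 : C * (1 - r) ≤ D / 8 := le_trans (by gcongr; linarith) ht0C
    have h9 : 0 ≤ 1 - r := by linarith
    nlinarith [mul_le_mul_of_nonneg_right h8 h9, mul_le_mul_of_nonneg_right h6 h9]

lemma aux_final (n : ℕ) (A a V : ℝ → ℝ) (m c3 c S ε k0 : ℝ) (hc3 : 0 < c3) (hc : 0 < c)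
    (hε : 0 < ε)
    (hA : ∀ k, k0 ≤ k → Real.exp (-(k * m) / (n + 1)) * a k ≤ A k)
    (ha : ∀ k, k0 ≤ k → c3 * Real.exp (k * m) * k ^ (-((n : ℝ) - 1 / 2)) ≤ a k)
    (hV0 : ∀ k, k0 ≤ k → 0 < V k)
    (hV : ∀ k, k0 ≤ k → V k ≤ a k / (k * c) + S * Real.exp (k * (m - ε))) :
    Tendsto (fun k => A k / V k ^ ((n : ℝ) / (n + 1))) atTop atTop := by
  have hn1 : (0 : ℝ) < n + 1 := by positivity
  set s := (n : ℝ) / (n + 1) with hs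
  have hs0 : 0 ≤ s := by positivity
  set q := 1 / ((n : ℝ) + 1) with hq
  have hq0 : 0 < q := by positivity
  have hsq : s + q = 1 := by rw [hs, hq]; field_simp
  set C4 := 1 / c + 1 with hC4
  have hC40 : 0 < C4 := by positivity
  have hsmall : ∀ᶠ k : ℝ in atTop, S * (k ^ ((n : ℝ) + 1 / 2) * Real.exp (-ε * k)) ≤ c3 := by
    have := (tendsto_rpow_mul_exp_neg_mul_atTop_nhds_zero ((n : ℝ) + 1 / 2) ε hε).const_mul S
    rw [mul_zero] at this
    exact this.eventually_le_const hc3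
  have hlim : Tendsto (fun k : ℝ => (C4 ^ s)⁻¹ * c3 ^ q * k ^ (q / 2)) atTop atTop :=
    (tendsto_rpow_atTop (by positivity)).const_mul_atTop (by positivity)
  refine tendsto_atTop_mono' _ ?_ hlim
  filter_upwards [hsmall, eventually_ge_atTop k0, eventually_gt_atTop 0] with k h1 h2 hk
  have ha' := ha k h2
  have hapos : 0 < a k := lt_of_lt_of_le (by positivity) ha'
  set b := Real.exp (-(k * m)) * a k with hb
  have hbpos : 0 < b := by positivity
  have hbl : c3 * k ^ (-((n : ℝ) - 1 / 2)) ≤ b := by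
    calc c3 * k ^ (-((n : ℝ) - 1 / 2)) = Real.exp (-(k * m)) * (c3 * Real.exp (k * m) * k ^ (-((n : ℝ) - 1 / 2))) := by
          rw [Real.exp_neg]; field_simp
      _ ≤ _ := by rw [hb]; gcongr
  have hSb : S * Real.exp (k * (m - ε)) ≤ a k / k := by
    rw [le_div_iff₀ hk]
    refine le_trans ?_ ha'
    have e1 : k ^ (-((n : ℝ) - 1 / 2)) * k ^ ((n : ℝ) + 1 / 2) = k := by
      rw [← Real.rpow_add hk]; ring_nf; exact Real.rpow_one k
    have e2 : Real.exp (k * (m - ε)) = Real.exp (k * m) * Real.exp (-ε * k) := by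
      rw [← Real.exp_add]; ring_nf
    calc S * Real.exp (k * (m - ε)) * k
        = (S * (k ^ ((n : ℝ) + 1 / 2) * Real.exp (-ε * k))) * Real.exp (k * m) * k ^ (-((n : ℝ) - 1 / 2)) := by
          rw [e2]
          calc _ = S * (Real.exp (k * m) * Real.exp (-ε * k)) *
                (k ^ (-((n : ℝ) - 1 / 2)) * k ^ ((n : ℝ) + 1 / 2)) := by rw [e1]
            _ = _ := by ring
      _ ≤ _ := by gcongr
  have hVk : V k ≤ C4 * (a k / k) := by
    refine (hV k h2).trans ?_
    have : C4 * (a k / k) = a k / (k * c) + a k / k := by rw [hC4]; field_simp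
    rw [this]; linarith
  have hVp := hV0 k h2
  calc (C4 ^ s)⁻¹ * c3 ^ q * k ^ (q / 2)
      = (C4 ^ s)⁻¹ * k ^ s * (c3 * k ^ (-((n : ℝ) - 1 / 2))) ^ q := by
        rw [Real.mul_rpow hc3.le (by positivity), ← Real.rpow_mul hk.le]
        have : q / 2 = s + (-((n : ℝ) - 1 / 2)) * q := by rw [hs, hq]; field_simp; ring
        rw [this, Real.rpow_add hk]; ring
    _ ≤ (C4 ^ s)⁻¹ * k ^ s * b ^ q := by gcongr
    _ = Real.exp (-(k * m) / (n + 1)) * a k / (C4 * (a k / k)) ^ s := by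
        rw [hb, Real.mul_rpow (by positivity) hapos.le, ← Real.exp_mul,
          Real.mul_rpow hC40.le (by positivity), Real.div_rpow hapos.le hk.le]
        have e3 : a k = a k ^ s * a k ^ q := by rw [← Real.rpow_add hapos, hsq, Real.rpow_one]
        have e4 : -(k * m) * q = -(k * m) / (n + 1) := by rw [hq]; ring
        have : 0 < a k ^ s := by positivity
        have : 0 < k ^ s := by positivity
        have : 0 < C4 ^ s := by positivity
        rw [e4]
        nth_rw 2 [e3]
        field_simp
    _ ≤ A k / V k ^ s := by
        have := hA k h2
        have : 0 < V k ^ s := by positivity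
        gcongr
        exact le_trans (by positivity) (hA k h2)

lemma aux_fin (n : ℕ)
    (σ : Measure (sphere (0 : EuclideanSpace ℂ (Fin n)) 1))
    (hσ : ∀ h : EuclideanSpace ℂ (Fin n) → ENNReal, Measurable h →
      ∫⁻ x, h x = ∫⁻ ω : sphere (0 : EuclideanSpace ℂ (Fin n)) 1,
        (∫⁻ r in Set.Ioi (0 : ℝ),
          h (r • (ω : EuclideanSpace ℂ (Fin n))) * ENNReal.ofReal (r ^ (2 * n - 1))) ∂σ) :
    IsFiniteMeasure σ := by
  have h1 := hσ ((closedBall 0 2).indicator 1) (measurable_one.indicator measurableSet_closedBall)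
  rw [lintegral_indicator_one measurableSet_closedBall] at h1
  refine ⟨lt_of_le_of_lt ?_ (measure_closedBall_lt_top (μ := volume) (x := (0 : EuclideanSpace ℂ (Fin n))) (r := 2))⟩
  rw [h1]
  calc σ Set.univ = ∫⁻ ω, 1 ∂σ := by simp
    _ ≤ _ := lintegral_mono fun ω => ?_
  have hw1 : ‖(ω : EuclideanSpace ℂ (Fin n))‖ = 1 := by simp
  calc (1 : ENNReal) = ∫⁻ r in Set.Ioc (1:ℝ) 2, 1 := by norm_num
    _ ≤ ∫⁻ r in Set.Ioc (1:ℝ) 2, (closedBall 0 2).indicator 1 (r • (ω : EuclideanSpace ℂ (Fin n))) * ENNReal.ofReal (r ^ (2 * n - 1)) := by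
      refine setLIntegral_mono' measurableSet_Ioc fun r hr => ?_
      rw [Set.indicator_of_mem]
      · rw [Pi.one_apply, one_mul, ENNReal.one_le_ofReal]
        exact one_le_pow₀ hr.1.le
      · rw [mem_closedBall_zero_iff, norm_smul, hw1, mul_one, Real.norm_of_nonneg (by linarith [hr.1])]
        exact hr.2
    _ ≤ _ := lintegral_mono_set fun r hr => lt_trans one_pos hr.1

lemma aux_cap (n : ℕ) (hn : 1 ≤ n)
    (σ : Measure (sphere (0 : EuclideanSpace ℂ (Fin n)) 1))
    (hσ : ∀ h : EuclideanSpace ℂ (Fin n) → ENNReal, Measurable h →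
      ∫⁻ x, h x = ∫⁻ ω : sphere (0 : EuclideanSpace ℂ (Fin n)) 1,
        (∫⁻ r in Set.Ioi (0 : ℝ),
          h (r • (ω : EuclideanSpace ℂ (Fin n))) * ENNReal.ofReal (r ^ (2 * n - 1))) ∂σ)
    (p : EuclideanSpace ℂ (Fin n)) (hps : p ∈ sphere (0 : EuclideanSpace ℂ (Fin n)) 1) :
    ∃ c : ℝ, 0 < c ∧ ∀ ρ : ℝ, 0 < ρ → ρ ≤ 1 →
      c * ρ ^ (2 * n - 1) ≤ σ.real {ω | ‖(ω : EuclideanSpace ℂ (Fin n)) - p‖ < 2 * ρ} := by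
  have := aux_fin n σ hσ
  have hp1 : ‖p‖ = 1 := by simpa using hps
  set v0 := (volume : Measure (EuclideanSpace ℂ (Fin n))).real (ball 0 1) with hv0
  have hv0p : 0 < v0 := ENNReal.toReal_pos (measure_ball_pos _ _ one_pos).ne' measure_ball_lt_top.ne
  refine ⟨v0 / (2 * 2 ^ (2 * n - 1)), by positivity, fun ρ hρ hρ1 => ?_⟩
  set cap : Set (sphere (0 : EuclideanSpace ℂ (Fin n)) 1) :=
    {ω | ‖(ω : EuclideanSpace ℂ (Fin n)) - p‖ < 2 * ρ} with hcap
  have hcapm : MeasurableSet cap :=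
    (isOpen_lt (by fun_prop) continuous_const).measurableSet
  have h1 := hσ ((ball p ρ).indicator 1) (measurable_one.indicator measurableSet_ball)
  rw [lintegral_indicator_one measurableSet_ball] at h1
  have h2 : volume (ball p ρ) ≤ ENNReal.ofReal (2 ^ (2 * n - 1)) * ENNReal.ofReal (2 * ρ) * σ cap := by
    rw [h1, ← lintegral_indicator_const hcapm]
    refine lintegral_mono fun ω => ?_
    have hw1 : ‖(ω : EuclideanSpace ℂ (Fin n))‖ = 1 := by simp
    have key : ∀ r : ℝ, 0 < r → r • (ω : EuclideanSpace ℂ (Fin n)) ∈ ball p ρ → |1 - r| < ρ ∧ ω ∈ cap := by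
      intro r hr hm
      rw [mem_ball] at hm
      have hrw : ‖r • (ω : EuclideanSpace ℂ (Fin n))‖ = r := by rw [norm_smul, hw1, Real.norm_of_nonneg hr.le, mul_one]
      have a1 : |1 - r| < ρ := by
        have := abs_norm_sub_norm_le p (r • (ω : EuclideanSpace ℂ (Fin n)))
        rw [hp1, hrw, ← dist_eq_norm, dist_comm] at this
        linarith
      refine ⟨a1, ?_⟩
      have h3 : dist (ω : EuclideanSpace ℂ (Fin n)) (r • ω) = |1 - r| := by
        rw [dist_eq_norm, show (ω : EuclideanSpace ℂ (Fin n)) - r • (ω : EuclideanSpace ℂ (Fin n)) = (1 - r) • (ω : EuclideanSpace ℂ (Fin n)) by rw [sub_smul, one_smul], norm_smul, hw1,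
          Real.norm_eq_abs, mul_one]
      rw [hcap, Set.mem_ofPred_eq, ← dist_eq_norm]
      linarith [dist_triangle (ω : EuclideanSpace ℂ (Fin n)) (r • ω) p]
    by_cases hω : ω ∈ cap
    · rw [Set.indicator_of_mem hω]
      calc _ ≤ ∫⁻ r in Set.Ioi (0:ℝ), (Set.Icc (1 - ρ) (1 + ρ)).indicator (fun _ => ENNReal.ofReal (2 ^ (2 * n - 1))) r := by
            refine setLIntegral_mono' measurableSet_Ioi fun r hr => ?_
            by_cases hm : r • (ω : EuclideanSpace ℂ (Fin n)) ∈ ball p ρ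
            · have := abs_lt.1 (key r hr hm).1
              rw [Set.indicator_of_mem hm, Set.indicator_of_mem (by constructor <;> linarith),
                Pi.one_apply, one_mul]
              have h0 : (0:ℝ) ≤ r := le_of_lt hr
              gcongr
              linarith
            · rw [Set.indicator_of_notMem hm, zero_mul]; exact zero_le
        _ ≤ ∫⁻ r, (Set.Icc (1 - ρ) (1 + ρ)).indicator (fun _ => ENNReal.ofReal (2 ^ (2 * n - 1))) r :=
            setLIntegral_le_lintegral _ _
        _ = _ := by
            rw [lintegral_indicator_const measurableSet_Icc, Real.volume_Icc]
            congr 2; ring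
    · rw [Set.indicator_of_notMem hω]
      refine le_of_eq ?_
      rw [setLIntegral_congr_fun (g := fun _ => 0) measurableSet_Ioi]
      · simp
      · intro r hr
        have : r • (ω : EuclideanSpace ℂ (Fin n)) ∉ ball p ρ := fun hm => hω (key r hr hm).2
        simp only [Set.indicator_of_notMem this, zero_mul]
  have hvol : volume (ball p ρ) = ENNReal.ofReal (ρ ^ (2 * n)) * volume (ball (0 : EuclideanSpace ℂ (Fin n)) 1) := by
    rw [Measure.addHaar_ball_of_pos _ _ hρ, finrank_real_of_complex]; simp
  have h3 := ENNReal.toReal_mono (by finiteness) h2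
  rw [hvol, ENNReal.toReal_mul, ENNReal.toReal_mul, ENNReal.toReal_mul,
    ENNReal.toReal_ofReal (by positivity), ENNReal.toReal_ofReal (by positivity),
    ENNReal.toReal_ofReal (by positivity)] at h3
  change ρ ^ (2 * n) * v0 ≤ 2 ^ (2 * n - 1) * (2 * ρ) * σ.real cap at h3
  have e : ρ ^ (2 * n) = ρ ^ (2 * n - 1) * ρ := by
    rw [← pow_succ]; congr 1; omega
  rw [e] at h3
  rw [div_mul_eq_mul_div, div_le_iff₀ (by positivity)]
  refine le_of_mul_le_mul_right ?_ hρ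
  linarith

lemma aux_upper (n : ℕ)
    (σ : Measure (sphere (0 : EuclideanSpace ℂ (Fin n)) 1))
    (hσ : ∀ h : EuclideanSpace ℂ (Fin n) → ENNReal, Measurable h →
      ∫⁻ x, h x = ∫⁻ ω : sphere (0 : EuclideanSpace ℂ (Fin n)) 1,
        (∫⁻ r in Set.Ioi (0 : ℝ),
          h (r • (ω : EuclideanSpace ℂ (Fin n))) * ENNReal.ofReal (r ^ (2 * n - 1))) ∂σ)
    (g : EuclideanSpace ℂ (Fin n) → ℝ)
    (hg : ContinuousOn g (closedBall (0 : EuclideanSpace ℂ (Fin n)) 1))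
    (m c ε k : ℝ) (hc : 0 < c) (hk : 0 < k)
    (h : ∀ w ∈ sphere (0 : EuclideanSpace ℂ (Fin n)) 1,
      ∀ r : ℝ, 0 < r → r ≤ 1 → g (r • w) ≤ g w - c * (1 - r) ∨ g (r • w) ≤ m - ε) :
    ∫ x in closedBall (0 : EuclideanSpace ℂ (Fin n)) 1, Real.exp (k * g x) ≤
      (∫ ω : sphere (0 : EuclideanSpace ℂ (Fin n)) 1, Real.exp (k * g ω) ∂σ) / (k * c)
        + σ.real Set.univ * Real.exp (k * (m - ε)) := by
  have := aux_fin n σ hσ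
  have hgs : Continuous fun ω : sphere (0 : EuclideanSpace ℂ (Fin n)) 1 => g ω :=
    (hg.mono sphere_subset_closedBall).domRestrict
  have hints : Integrable (fun ω : sphere (0 : EuclideanSpace ℂ (Fin n)) 1 => Real.exp (k * g ω)) σ :=
    Continuous.integrable_of_hasCompactSupport (Real.continuous_exp.comp (continuous_const.mul hgs)) (HasCompactSupport.of_compactSpace _)
  have hkc : 0 < k * c := by positivity
  classical
  set H : EuclideanSpace ℂ (Fin n) → ENNReal :=
    (closedBall (0 : EuclideanSpace ℂ (Fin n)) 1).piecewise (fun x => ENNReal.ofReal (Real.exp (k * g x))) (fun _ => 0) with hH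
  have hHm : Measurable H := by
    refine ContinuousOn.measurable_piecewise ?_ continuousOn_const measurableSet_closedBall
    exact ENNReal.continuous_ofReal.comp_continuousOn (Real.continuous_exp.comp_continuousOn (continuousOn_const.mul hg))
  have h1 := hσ H hHm
  have h2 : ∫⁻ x, H x = ∫⁻ x in closedBall (0 : EuclideanSpace ℂ (Fin n)) 1, ENNReal.ofReal (Real.exp (k * g x)) := by
    rw [← lintegral_indicator measurableSet_closedBall]
    rfl
  have hexp : ∫⁻ r in Set.Ioc (0:ℝ) 1, ENNReal.ofReal (Real.exp (k * c * r - k * c)) ≤ ENNReal.ofReal (1 / (k * c)) := by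
    rw [← ofReal_integral_eq_lintegral_ofReal]
    · apply ENNReal.ofReal_le_ofReal
      rw [← intervalIntegral.integral_of_le zero_le_one,
        intervalIntegral.integral_comp_mul_sub (fun x => Real.exp x) hkc.ne', integral_exp]
      simp only [smul_eq_mul, mul_one, sub_self, Real.exp_zero, mul_zero, zero_sub]
      rw [one_div]
      exact mul_le_of_le_one_right (by positivity) (by linarith [Real.exp_pos (-(k * c))])
    · exact (Continuous.integrableOn_Ioc (by fun_prop))
    · exact Eventually.of_forall fun r => (Real.exp_pos _).le
  have h3 : ∀ ω : sphere (0 : EuclideanSpace ℂ (Fin n)) 1, (∫⁻ r in Set.Ioi (0 : ℝ),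
          H (r • (ω : EuclideanSpace ℂ (Fin n))) * ENNReal.ofReal (r ^ (2 * n - 1))) ≤
        ENNReal.ofReal (Real.exp (k * g ω)) * ENNReal.ofReal (1 / (k * c)) + ENNReal.ofReal (Real.exp (k * (m - ε))) := by
    intro ω
    have hw1 : ‖(ω : EuclideanSpace ℂ (Fin n))‖ = 1 := by simp
    calc _ ≤ ∫⁻ r in Set.Ioi (0:ℝ), (Set.Ioc (0:ℝ) 1).indicator (fun r =>
            ENNReal.ofReal (Real.exp (k * g ω)) * ENNReal.ofReal (Real.exp (k * c * r - k * c)) +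
              ENNReal.ofReal (Real.exp (k * (m - ε)))) r := by
          refine setLIntegral_mono' measurableSet_Ioi fun r hr => ?_
          have hr0 : 0 < r := hr
          have hrw : ‖r • (ω : EuclideanSpace ℂ (Fin n))‖ = r := by rw [norm_smul, hw1, Real.norm_of_nonneg hr0.le, mul_one]
          by_cases hr1 : r ≤ 1
          · rw [Set.indicator_of_mem (show r ∈ Set.Ioc (0:ℝ) 1 from ⟨hr0, hr1⟩), hH,
              Set.piecewise_eq_of_mem _ _ _ (by rw [mem_closedBall_zero_iff, hrw]; exact hr1),
              ← ENNReal.ofReal_mul (by positivity), ← ENNReal.ofReal_mul (by positivity),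
              ← ENNReal.ofReal_add (by positivity) (by positivity), ← Real.exp_add]
            apply ENNReal.ofReal_le_ofReal
            refine (mul_le_of_le_one_right (Real.exp_pos _).le (pow_le_one₀ hr0.le hr1)).trans ?_
            rcases h ω ω.2 r hr0 hr1 with h4 | h4
            · have : Real.exp (k * g (r • (ω : EuclideanSpace ℂ (Fin n)))) ≤ Real.exp (k * g ω + (k * c * r - k * c)) := by
                apply Real.exp_le_exp.2
                nlinarith [mul_le_mul_of_nonneg_left h4 hk.le]
              linarith [Real.exp_pos (k * (m - ε))]
            · have : Real.exp (k * g (r • (ω : EuclideanSpace ℂ (Fin n)))) ≤ Real.exp (k * (m - ε)) := by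
                apply Real.exp_le_exp.2
                gcongr
              linarith [Real.exp_pos (k * g ω + (k * c * r - k * c))]
          · rw [hH, Set.piecewise_eq_of_notMem _ _ _ (by rw [mem_closedBall_zero_iff, hrw]; exact hr1), zero_mul]
            exact zero_le
      _ ≤ ∫⁻ r, (Set.Ioc (0:ℝ) 1).indicator (fun r =>
            ENNReal.ofReal (Real.exp (k * g ω)) * ENNReal.ofReal (Real.exp (k * c * r - k * c)) +
              ENNReal.ofReal (Real.exp (k * (m - ε)))) r := setLIntegral_le_lintegral _ _
      _ = ENNReal.ofReal (Real.exp (k * g ω)) * (∫⁻ r in Set.Ioc (0:ℝ) 1, ENNReal.ofReal (Real.exp (k * c * r - k * c)))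
            + ENNReal.ofReal (Real.exp (k * (m - ε))) := by
          rw [lintegral_indicator measurableSet_Ioc, lintegral_add_right _ measurable_const,
            lintegral_const_mul _ (by fun_prop)]
          simp
      _ ≤ _ := by gcongr
  have hms : Measurable fun ω : sphere (0 : EuclideanSpace ℂ (Fin n)) 1 =>
      ENNReal.ofReal (Real.exp (k * g ω)) :=
    (ENNReal.continuous_ofReal.comp (Real.continuous_exp.comp (continuous_const.mul hgs))).measurable
  have h4 : ∫⁻ x in closedBall (0 : EuclideanSpace ℂ (Fin n)) 1, ENNReal.ofReal (Real.exp (k * g x)) ≤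
      ENNReal.ofReal ((∫ ω : sphere (0 : EuclideanSpace ℂ (Fin n)) 1, Real.exp (k * g ω) ∂σ) / (k * c)
        + σ.real Set.univ * Real.exp (k * (m - ε))) := by
    rw [← h2, h1]
    refine (lintegral_mono h3).trans (le_of_eq ?_)
    rw [lintegral_add_right _ measurable_const, lintegral_mul_const _ hms,
      ← ofReal_integral_eq_lintegral_ofReal hints (Eventually.of_forall fun r => (Real.exp_pos _).le),
      lintegral_const, ENNReal.ofReal_add (by positivity) (by positivity), div_eq_mul_one_div (∫ ω : sphere (0 : EuclideanSpace ℂ (Fin n)) 1, Real.exp (k * g ω) ∂σ),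
      ENNReal.ofReal_mul (integral_nonneg fun _ => (Real.exp_pos _).le),
      ENNReal.ofReal_mul measureReal_nonneg, ofReal_measureReal, mul_comm (σ Set.univ)]
  have hintB : IntegrableOn (fun x => Real.exp (k * g x)) (closedBall (0 : EuclideanSpace ℂ (Fin n)) 1) :=
    ContinuousOn.integrableOn_compact (isCompact_closedBall _ _)
      (Real.continuous_exp.comp_continuousOn (continuousOn_const.mul hg))
  rw [← ofReal_integral_eq_lintegral_ofReal hintB (Eventually.of_forall fun r => (Real.exp_pos _).le)] at h4
  exact (ENNReal.ofReal_le_ofReal_iff (by positivity)).1 h4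

/-- For a holomorphic function `G` on a neighborhood of the closed unit ball in `ℂⁿ` with
`g = Re G` attaining its maximum on the ball at a unique point `p` lying on the unit sphere,
with strictly positive radial derivative at `p`, the ratio
`(∫_{S^{2n−1}} e^{(n/(n+1)) k g} dσ) / (∫_B e^{k g})^{n/(n+1)}` tends to `+∞` as `k → ∞`.
Here `σ` is the surface measure on the sphere, characterized by the polar-coordinates
formula. -/
theorem ratio_tendsto_atTop_of_generic (n : ℕ) (hn : 1 ≤ n)
    (σ : Measure (sphere (0 : EuclideanSpace ℂ (Fin n)) 1))
    (hσ : ∀ h : EuclideanSpace ℂ (Fin n) → ENNReal, Measurable h →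
      ∫⁻ x, h x = ∫⁻ ω : sphere (0 : EuclideanSpace ℂ (Fin n)) 1,
        (∫⁻ r in Set.Ioi (0 : ℝ),
          h (r • (ω : EuclideanSpace ℂ (Fin n))) * ENNReal.ofReal (r ^ (2 * n - 1))) ∂σ)
    (U : Set (EuclideanSpace ℂ (Fin n))) (hU : IsOpen U)
    (hBU : closedBall (0 : EuclideanSpace ℂ (Fin n)) 1 ⊆ U)
    (G : EuclideanSpace ℂ (Fin n) → ℂ) (hG : DifferentiableOn ℂ G U)
    (p : EuclideanSpace ℂ (Fin n))
    (hp : p ∈ closedBall (0 : EuclideanSpace ℂ (Fin n)) 1)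
    (hmax : ∀ x ∈ closedBall (0 : EuclideanSpace ℂ (Fin n)) 1, (G x).re ≤ (G p).re)
    (huniq : ∀ x ∈ closedBall (0 : EuclideanSpace ℂ (Fin n)) 1,
      (G x).re = (G p).re → x = p)
    (hps : p ∈ sphere (0 : EuclideanSpace ℂ (Fin n)) 1)
    (hrad : 0 < fderiv ℝ (fun z => (G z).re) p p) :
    Tendsto (fun k : ℝ =>
        (∫ ω : sphere (0 : EuclideanSpace ℂ (Fin n)) 1,
          Real.exp (((n : ℝ) / (n + 1)) * k * (G (ω : EuclideanSpace ℂ (Fin n))).re) ∂σ) /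
        (∫ x in closedBall (0 : EuclideanSpace ℂ (Fin n)) 1,
          Real.exp (k * (G x).re)) ^ ((n : ℝ) / (n + 1)))
      atTop atTop := by
  have hfin := aux_fin n σ hσ
  obtain ⟨c, ε, hc, hε, hradial⟩ := aux_radial n U hU hBU G hG p hmax huniq hps hrad
  obtain ⟨C, R, hC, hR, hlow⟩ := aux_lower n U hU hBU G hG p hmax hps hrad
  obtain ⟨c2, hc2, hcap⟩ := aux_cap n hn σ hσ p hps
  have hg : ContinuousOn (fun x => (G x).re) (closedBall (0 : EuclideanSpace ℂ (Fin n)) 1) :=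
    Complex.continuous_re.comp_continuousOn (hG.continuousOn.mono hBU)
  have hgs : Continuous fun ω : sphere (0 : EuclideanSpace ℂ (Fin n)) 1 =>
      (G (ω : EuclideanSpace ℂ (Fin n))).re :=
    (hg.mono sphere_subset_closedBall).domRestrict
  have hints : ∀ k : ℝ, Integrable (fun ω : sphere (0 : EuclideanSpace ℂ (Fin n)) 1 =>
      Real.exp (k * (G (ω : EuclideanSpace ℂ (Fin n))).re)) σ := fun k =>
    Continuous.integrable_of_hasCompactSupport (Real.continuous_exp.comp (continuous_const.mul hgs))
      (HasCompactSupport.of_compactSpace _)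
  have hn1 : (0 : ℝ) < n + 1 := by positivity
  refine aux_final n _ (fun k => ∫ ω : sphere (0 : EuclideanSpace ℂ (Fin n)) 1,
    Real.exp (k * (G (ω : EuclideanSpace ℂ (Fin n))).re) ∂σ) _ (G p).re
    (c2 * Real.exp (-(4 * C))) c (σ.real Set.univ) ε (max 1 (4 / R ^ 2 + 1))
    (by positivity) hc hε ?_ ?_ ?_ ?_
  · intro k hk
    have hk1 : 1 ≤ k := (le_max_left _ _).trans hk
    rw [← integral_const_mul]
    refine integral_mono ((hints k).const_mul _) (hints _) fun ω => ?_
    dsimp only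
    rw [← Real.exp_add]
    apply Real.exp_le_exp.2
    have h1 := hmax ω (sphere_subset_closedBall ω.2)
    have h2 : -(k * (G p).re) / (n + 1) + k * (G (ω : EuclideanSpace ℂ (Fin n))).re
        = (n : ℝ) / (n + 1) * k * (G (ω : EuclideanSpace ℂ (Fin n))).re
          - k / (n + 1) * ((G p).re - (G (ω : EuclideanSpace ℂ (Fin n))).re) := by
      field_simp; ring
    rw [h2]
    have : 0 ≤ k / (n + 1) * ((G p).re - (G (ω : EuclideanSpace ℂ (Fin n))).re) :=
      mul_nonneg (by positivity) (by linarith)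
    linarith
  · intro k hk
    have hk1 : 1 ≤ k := (le_max_left _ _).trans hk
    have hkR : 4 / R ^ 2 < k := by linarith [(le_max_right 1 (4 / R ^ 2 + 1)).trans hk]
    have hk0 : 0 < k := by linarith
    have hsk : 0 < √k := Real.sqrt_pos.2 hk0
    have hsk2 : √k ^ 2 = k := Real.sq_sqrt hk0.le
    have hρ := hcap (1 / √k) (by positivity) (by
      rw [div_le_one hsk]; exact Real.one_le_sqrt.2 hk1)
    have hρR : 2 * (1 / √k) < R := by
      rw [div_lt_iff₀ (by positivity)] at hkR
      rw [mul_one_div, div_lt_iff₀ hsk]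
      nlinarith [mul_pos hR hsk]
    have hpow : (1 / √k) ^ (2 * n - 1) = k ^ (-((n : ℝ) - 1 / 2)) := by
      rw [one_div, Real.sqrt_eq_rpow, ← Real.rpow_neg hk0.le, ← Real.rpow_natCast,
        ← Real.rpow_mul hk0.le]
      congr 1
      rw [Nat.cast_sub (by omega)]
      push_cast; ring
    rw [hpow] at hρ
    set cap : Set (sphere (0 : EuclideanSpace ℂ (Fin n)) 1) :=
      {ω | ‖(ω : EuclideanSpace ℂ (Fin n)) - p‖ < 2 * (1 / √k)} with hcapd
    have hcapm : MeasurableSet cap :=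
      (isOpen_lt (by fun_prop) continuous_const).measurableSet
    have h1 : ∫ ω, cap.indicator (fun _ => Real.exp (k * (G p).re - 4 * C)) ω ∂σ ≤
        ∫ ω : sphere (0 : EuclideanSpace ℂ (Fin n)) 1,
          Real.exp (k * (G (ω : EuclideanSpace ℂ (Fin n))).re) ∂σ := by
      refine integral_mono ((integrable_const _).indicator hcapm) (hints k) fun ω => ?_
      by_cases hω : ω ∈ cap
      · rw [Set.indicator_of_mem hω]
        apply Real.exp_le_exp.2
        have hω' : ‖(ω : EuclideanSpace ℂ (Fin n)) - p‖ < 2 * (1 / √k) := hω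
        have h2 := hlow ω ω.2 (hω'.trans hρR)
        have h3 : ‖(ω : EuclideanSpace ℂ (Fin n)) - p‖ ^ 2 ≤ 4 / k := by
          calc _ ≤ (2 * (1 / √k)) ^ 2 := by gcongr
            _ = 4 / k := by rw [mul_pow, div_pow, hsk2]; ring
        have h4 : k * (C * ‖(ω : EuclideanSpace ℂ (Fin n)) - p‖ ^ 2) ≤ 4 * C := by
          calc _ ≤ k * (C * (4 / k)) := by gcongr
            _ = 4 * C := by field_simp
        have h5 := mul_le_mul_of_nonneg_left h2 hk0.le
        rw [mul_sub] at h5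
        linarith
      · rw [Set.indicator_of_notMem hω]; exact (Real.exp_pos _).le
    refine le_trans ?_ h1
    rw [integral_indicator_const _ hcapm, smul_eq_mul, sub_eq_add_neg (k * (G p).re), Real.exp_add]
    calc _ = c2 * k ^ (-((n : ℝ) - 1 / 2)) * (Real.exp (k * (G p).re) * Real.exp (-(4 * C))) := by ring
      _ ≤ _ := by gcongr
  · intro k hk
    have hintB : IntegrableOn (fun x => Real.exp (k * (G x).re))
        (closedBall (0 : EuclideanSpace ℂ (Fin n)) 1) :=
      ContinuousOn.integrableOn_compact (isCompact_closedBall _ _)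
        (Real.continuous_exp.comp_continuousOn (continuousOn_const.mul hg))
    have : NeZero ((volume : Measure (EuclideanSpace ℂ (Fin n))).restrict (closedBall 0 1)) :=
      ⟨fun h => (measure_closedBall_pos volume (0 : EuclideanSpace ℂ (Fin n)) one_pos).ne'
        (Measure.restrict_eq_zero.1 h)⟩
    exact integral_exp_pos hintB
  · intro k hk
    have hk1 : 1 ≤ k := (le_max_left _ _).trans hk
    exact aux_upper n σ hσ (fun x => (G x).re) hg (G p).re c ε k hc (by linarith) hradial
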